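/- arXiv:2501.06541 — 4 statements merged into one kernel-verified Lean document; each statement's English description precedes it below -/
import Mathlib

section
/- Let R be a commutative ring, N a finitely generated projective R-module, and T : N → N an R-linear endomorphism whose cokernel N/T(N) is a projective R-module. Then for every commutative R-algebra S, the canonical S-linear map ker(T) ⊗_R S → ker(T ⊗_R id_S : N ⊗_R S → N ⊗_R S) is an isomorphism. -/
/-- Let `N` be a finitely generated projective module over a commutative ring `R`, and
`T : N → N` an `R`-linear endomorphism whose cokernel is projective.  Then for every
commutative `R`-algebra `S`, the canonical `S`-linear map `ker T ⊗[R] S → ker (T ⊗ id_S)` is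
an isomorphism (expressed here as: the base change of the inclusion `ker T ↪ N` is injective
with range exactly the kernel of the base change of `T`). -/
theorem baseChange_ker_eq_ker_baseChange
    {R N : Type*} [CommRing R] [AddCommGroup N] [Module R N]
    [Module.Finite R N] [Module.Projective R N] (T : N →ₗ[R] N)
    (hcoker : Module.Projective R (N ⧸ LinearMap.range T))
    (S : Type*) [CommRing S] [Algebra R S] :
    Function.Injective ((LinearMap.ker T).subtype.baseChange S) ∧
      LinearMap.range ((LinearMap.ker T).subtype.baseChange S)
        = LinearMap.ker (T.baseChange S) := by
  obtain ⟨σ, hσ⟩ := LinearMap.exists_rightInverse_of_surjective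
    (LinearMap.range T).mkQ (LinearMap.range T).range_mkQ
  have hσ' : ∀ y, (LinearMap.range T).mkQ (σ y) = y := fun y => LinearMap.congr_fun hσ y
  let e : N →ₗ[R] LinearMap.range T :=
    (LinearMap.id - σ ∘ₗ (LinearMap.range T).mkQ).codRestrict (LinearMap.range T) (by
      intro x
      refine (Submodule.Quotient.mk_eq_zero (LinearMap.range T)).1 ?_
      rw [← Submodule.mkQ_apply]
      simp only [LinearMap.sub_apply, LinearMap.id_apply, LinearMap.comp_apply, map_sub]
      rw [hσ', sub_self])
  have he : e ∘ₗ (LinearMap.range T).subtype = LinearMap.id := by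
    ext x
    have h0 : (LinearMap.range T).mkQ (x : N) = 0 := by
      rw [← LinearMap.mem_ker, Submodule.ker_mkQ]
      exact x.2
    change (x : N) - σ ((LinearMap.range T).mkQ (x : N)) = x
    rw [h0, map_zero, sub_zero]
  have hproj : Module.Projective R (LinearMap.range T) :=
    Module.Projective.of_split (LinearMap.range T).subtype e he
  obtain ⟨s, hs⟩ := LinearMap.exists_rightInverse_of_surjective
    T.rangeRestrict T.range_rangeRestrict
  let g : N →ₗ[R] N := s ∘ₗ e
  have hg : ∀ x, T (g (T x)) = T x := by
    intro x
    have h1 : e (T x) = T.rangeRestrict x := LinearMap.congr_fun he (T.rangeRestrict x)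
    have h2 := LinearMap.congr_fun hs (T.rangeRestrict x)
    change T (s (e (T x))) = T x
    rw [h1]
    exact congrArg Subtype.val h2
  let p : N →ₗ[R] LinearMap.ker T := (LinearMap.id - g ∘ₗ T).codRestrict (LinearMap.ker T) (by
    intro x
    simp [hg])
  have hp1 : p ∘ₗ (LinearMap.ker T).subtype = LinearMap.id := by
    ext x
    change (x : N) - g (T x) = x
    rw [LinearMap.mem_ker.1 x.2, map_zero, sub_zero]
  have hp2 : (LinearMap.ker T).subtype ∘ₗ p + g ∘ₗ T = LinearMap.id := by
    ext x
    change (x - g (T x)) + g (T x) = x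
    rw [sub_add_cancel]
  constructor
  · apply Function.LeftInverse.injective (g := p.baseChange S)
    intro x
    rw [← LinearMap.comp_apply, ← LinearMap.baseChange_comp, hp1, LinearMap.baseChange_id,
      LinearMap.id_apply]
  · apply le_antisymm
    · rintro _ ⟨y, rfl⟩
      rw [LinearMap.mem_ker, ← LinearMap.comp_apply, ← LinearMap.baseChange_comp,
        LinearMap.comp_ker_subtype, LinearMap.baseChange_zero, LinearMap.zero_apply]
    · intro x hx
      rw [LinearMap.mem_ker] at hx
      have h := LinearMap.congr_fun (congrArg (LinearMap.baseChange S) hp2) x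
      rw [LinearMap.baseChange_add, LinearMap.baseChange_comp, LinearMap.baseChange_comp,
        LinearMap.add_apply, LinearMap.comp_apply, LinearMap.comp_apply, hx, map_zero, add_zero,
        LinearMap.baseChange_id, LinearMap.id_apply] at h
      exact ⟨_, h⟩
end

section
/- Let S be a commutative ring that is injective as a module over itself, and let M be an S-module such that the canonical evaluation map M → Hom_S(Hom_S(M,S), S) is surjective. Let δ ∈ Hom_S(M, S). Then the S-linear map Hom_S(S·δ, S) → S sending ψ to ψ(δ) is injective, and its range equals the range of δ (as an ideal of S). In particular Hom_S(S·δ, S) is isomorphic to im(δ). -/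
/-- Let `S` be a commutative ring that is injective as a module over itself, and `M` an
`S`-module whose double-dual evaluation map is surjective.  For `δ ∈ Hom_S(M, S)`, the
`S`-linear map `Hom_S(S·δ, S) → S`, `ψ ↦ ψ(δ)`, is injective with range equal to the range of
`δ` (an ideal of `S`); in particular `Hom_S(S·δ, S)` is isomorphic to `im δ`. -/
theorem dual_of_cyclic_submodule_eq_image
    {S M : Type*} [CommRing S] [AddCommGroup M] [Module S M]
    (hinj : Module.Injective S S)
    (hsurj : Function.Surjective (Module.Dual.eval S M))
    (δ : Module.Dual S M) :
    Function.Injective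
      (Module.Dual.eval S ↥(Submodule.span S ({δ} : Set (Module.Dual S M)))
        ⟨δ, Submodule.mem_span_singleton_self δ⟩) ∧
    LinearMap.range
      (Module.Dual.eval S ↥(Submodule.span S ({δ} : Set (Module.Dual S M)))
        ⟨δ, Submodule.mem_span_singleton_self δ⟩) = LinearMap.range δ ∧
    Nonempty (Module.Dual S ↥(Submodule.span S ({δ} : Set (Module.Dual S M)))
      ≃ₗ[S] ↥(LinearMap.range δ)) := by
  have hI : Function.Injective
      (Module.Dual.eval S ↥(Submodule.span S ({δ} : Set (Module.Dual S M)))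
        ⟨δ, Submodule.mem_span_singleton_self δ⟩) := by
    intro f g h
    have h' : f ⟨δ, Submodule.mem_span_singleton_self δ⟩ =
      g ⟨δ, Submodule.mem_span_singleton_self δ⟩ := h
    apply LinearMap.ext
    rintro ⟨x, hx⟩
    obtain ⟨a, rfl⟩ := Submodule.mem_span_singleton.1 hx
    have e : (⟨a • δ, hx⟩ : ↥(Submodule.span S ({δ} : Set (Module.Dual S M)))) =
      a • ⟨δ, Submodule.mem_span_singleton_self δ⟩ := rfl
    rw [e, map_smul, map_smul, h']
  have hR : LinearMap.range
      (Module.Dual.eval S ↥(Submodule.span S ({δ} : Set (Module.Dual S M)))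
        ⟨δ, Submodule.mem_span_singleton_self δ⟩) = LinearMap.range δ := by
    ext s
    constructor
    · rintro ⟨f, rfl⟩
      obtain ⟨F, hF⟩ := (Module.Baer.of_injective hinj).extension_property
        (M := ↥(Submodule.span S ({δ} : Set (Module.Dual S M)))) (N := Module.Dual S M)
        (Submodule.span S ({δ} : Set (Module.Dual S M))).subtype
        (Submodule.injective_subtype _) f
      obtain ⟨m, hm⟩ := hsurj F
      refine ⟨m, ?_⟩
      rw [← hF, ← hm]
      rfl
    · rintro ⟨m, rfl⟩
      exact ⟨(Module.Dual.eval S M m).comp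
        (Submodule.span S ({δ} : Set (Module.Dual S M))).subtype, rfl⟩
  exact ⟨hI, hR, ⟨(LinearEquiv.ofInjective _ hI).trans (LinearEquiv.ofEq _ _ hR)⟩⟩
end

section
/- Let R be a commutative ring in which 2 is invertible, let a ∈ R, and let U = !![1, a; 0, 1]. Then the cokernel of the R-linear endomorphism of R⁴ given by the 4×4 matrix (U ⊗ₖ U) − 1, where ⊗ₖ denotes the Kronecker product of matrices, is isomorphic as an R-module to R² ⊕ (R/aR)². In particular, if a is a unit of R then this cokernel is free of rank 2. -/
open Kronecker

/-- Let `R` be a commutative ring with `2` invertible, `a ∈ R`, and `U = !![1, a; 0, 1]`.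
The cokernel of the endomorphism of `R⁴` given by the Kronecker product `U ⊗ₖ U` minus the
identity is isomorphic to `R² ⊕ (R/aR)²`; in particular if `a` is a unit this cokernel is
free of rank `2`. -/
theorem coker_kronecker_unipotent_sub_one
    {R : Type*} [CommRing R] [Invertible (2 : R)] (a : R) :
    Nonempty
      ((((Fin 2 × Fin 2) → R) ⧸
          LinearMap.range (Matrix.mulVecLin
            ((!![1, a; 0, 1] : Matrix (Fin 2) (Fin 2) R) ⊗ₖ !![1, a; 0, 1] - 1)))
        ≃ₗ[R] ((Fin 2 → R) × (Fin 2 → (R ⧸ Ideal.span ({a} : Set R))))) ∧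
    (IsUnit a →
      Nonempty
        ((((Fin 2 × Fin 2) → R) ⧸
            LinearMap.range (Matrix.mulVecLin
              ((!![1, a; 0, 1] : Matrix (Fin 2) (Fin 2) R) ⊗ₖ !![1, a; 0, 1] - 1)))
          ≃ₗ[R] (Fin 2 → R))) := by
  have key : Nonempty
      ((((Fin 2 × Fin 2) → R) ⧸
          LinearMap.range (Matrix.mulVecLin
            ((!![1, a; 0, 1] : Matrix (Fin 2) (Fin 2) R) ⊗ₖ !![1, a; 0, 1] - 1)))
        ≃ₗ[R] ((Fin 2 → R) × (Fin 2 → (R ⧸ Ideal.span ({a} : Set R))))) := by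
    let q : R →ₗ[R] (R ⧸ Ideal.span ({a} : Set R)) := (Ideal.span ({a} : Set R)).mkQ
    let p : Fin 2 → Fin 2 → (((Fin 2 × Fin 2) → R) →ₗ[R] R) := fun i j => LinearMap.proj (i, j)
    let f : ((Fin 2 × Fin 2) → R) →ₗ[R]
        ((Fin 2 → R) × (Fin 2 → (R ⧸ Ideal.span ({a} : Set R)))) :=
      (LinearMap.pi ![p 1 1, p 1 0 - p 0 1]).prod (LinearMap.pi ![q ∘ₗ p 0 0, q ∘ₗ p 0 1])
    have hq : ∀ r : R, q r = 0 ↔ ∃ c, r = a * c := by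
      intro r
      rw [show q r = (Ideal.span ({a} : Set R)).mkQ r from rfl, Submodule.mkQ_apply,
        Submodule.Quotient.mk_eq_zero, Ideal.mem_span_singleton]
      rfl
    have hM : ∀ x : (Fin 2 × Fin 2) → R, Matrix.mulVecLin
        ((!![1, a; 0, 1] : Matrix (Fin 2) (Fin 2) R) ⊗ₖ !![1, a; 0, 1] - 1) x =
        fun ij => !![a * (x (0, 1) + x (1, 0) + a * x (1, 1)), a * x (1, 1);
          a * x (1, 1), 0] ij.1 ij.2 := by
      intro x
      ext ⟨i, j⟩
      fin_cases i <;> fin_cases j <;>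
        simp [Matrix.mulVec, dotProduct, Fintype.sum_prod_type, Matrix.sub_apply,
          Matrix.one_apply] <;> ring
    have hf : Function.Surjective f := by
      rintro ⟨u, v⟩
      obtain ⟨c, hc⟩ := Submodule.mkQ_surjective (Ideal.span ({a} : Set R)) (v 0)
      obtain ⟨d, hd⟩ := Submodule.mkQ_surjective (Ideal.span ({a} : Set R)) (v 1)
      refine ⟨fun ij => !![c, d; u 1 + d, u 0] ij.1 ij.2, ?_⟩
      refine Prod.ext (funext fun i => ?_) (funext fun i => ?_)
      · fin_cases i <;> simp [f, p]
      · fin_cases i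
        · exact hc
        · exact hd
    have hk : LinearMap.range (Matrix.mulVecLin
        ((!![1, a; 0, 1] : Matrix (Fin 2) (Fin 2) R) ⊗ₖ !![1, a; 0, 1] - 1)) =
        LinearMap.ker f := by
      have hfy : ∀ y, f y = 0 ↔ (y (1, 1) = 0 ∧ y (1, 0) - y (0, 1) = 0) ∧
          (q (y (0, 0)) = 0 ∧ q (y (0, 1)) = 0) := by
        intro y
        simp [f, p, Prod.ext_iff, funext_iff, Fin.forall_fin_two]
      ext y
      rw [LinearMap.mem_ker, hfy, hq, hq, LinearMap.mem_range]
      constructor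
      · rintro ⟨x, rfl⟩
        rw [hM]
        refine ⟨⟨by simp, by simp⟩, ⟨_, rfl⟩, ⟨_, rfl⟩⟩
      · rintro ⟨⟨h1, h2⟩, ⟨c, hc⟩, ⟨d, hd⟩⟩
        refine ⟨fun ij => !![0, c - a * d; 0, d] ij.1 ij.2, ?_⟩
        rw [hM]
        have h3 := sub_eq_zero.mp h2
        ext ⟨i, j⟩
        fin_cases i <;> fin_cases j <;> simp [h1, h3, hc, hd]
    exact ⟨(Submodule.quotEquivOfEq _ _ hk).trans (f.quotKerEquivOfSurjective hf)⟩
  refine ⟨key, fun ha => ?_⟩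
  obtain ⟨e⟩ := key
  have hs : Subsingleton (R ⧸ Ideal.span ({a} : Set R)) :=
    Ideal.Quotient.subsingleton_iff.mpr (Ideal.span_singleton_eq_top.mpr ha)
  exact ⟨e.trans (LinearEquiv.ofBijective (LinearMap.fst R _ _)
    ⟨fun x y h => Prod.ext h (Subsingleton.elim _ _), LinearMap.fst_surjective⟩)⟩
end

section
/- Let K be a field, let n ≥ 1 and 0 ≤ a ≤ n be integers, let e₁, …, e_n be the standard basis of K^n, and let φ₁, …, φ_a be linear functionals on K^n. In the exterior algebra of K^n, the iterated left contraction ι_{φ_a}(⋯(ι_{φ₁}(e₁ ∧ ⋯ ∧ e_n))⋯) is nonzero if and only if φ₁, …, φ_a are linearly independent over K, equivalently if and only if the linear map K^n → K^a, x ↦ (φ₁(x), …, φ_a(x)), is surjective. -/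
theorem aux_surj_iff {K : Type*} [Field K] {n a : ℕ}
    (φ : Fin a → Module.Dual K (Fin n → K)) :
    LinearIndependent K φ ↔
      Function.Surjective fun x : Fin n → K => fun i : Fin a => φ i x := by
  have h1 : (fun x : Fin n → K => fun i : Fin a => φ i x) = ⇑(LinearMap.pi φ) := rfl
  rw [h1, ← LinearMap.dualMap_injective_iff, ← LinearMap.ker_eq_bot, LinearMap.ker_eq_bot',
    Fintype.linearIndependent_iff]
  constructor
  · intro h g hg
    have := h (fun i => g (Pi.single i 1)) (by
      rw [← hg]
      ext x
      simp only [LinearMap.coe_comp, Function.comp_apply, LinearMap.coe_single,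
        LinearMap.sum_apply, LinearMap.smul_apply, LinearMap.dualMap_apply, smul_eq_mul]
      conv_rhs => rw [LinearMap.pi_apply_eq_sum_univ g]
      refine Finset.sum_congr rfl fun i _ => ?_
      rw [LinearMap.pi_apply, smul_eq_mul, mul_comm]
      congr 2
      ext j
      simp [Pi.single_apply, eq_comm])
    ext i
    simpa using this i
  · intro h c hc i
    have := h (∑ i, c i • LinearMap.proj i) (by
      rw [← hc]
      ext x
      simp [LinearMap.dualMap_apply])
    have := congrArg (fun f => f (Pi.single i 1)) this
    simpa [Pi.single_apply] using this

theorem aux_nonzero {K : Type*} [Field K] {V : Type*} [AddCommGroup V] [Module K V] (a : ℕ) :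
    ∀ (φ : Fin a → Module.Dual K V) (W : Submodule K V) (w : ExteriorAlgebra K V),
      w ≠ 0 → (∀ x ∈ W, ExteriorAlgebra.ι K x * w = 0) →
      (∀ i, ∃ x ∈ W, φ i x = 1 ∧ ∀ j, j ≠ i → φ j x = 0) →
      (List.ofFn φ).foldl (fun v d => CliffordAlgebra.contractLeft d v) w ≠ 0 := by
  induction a with
  | zero => intro φ W w hw _ _; simpa using hw
  | succ a ih =>
    intro φ W w hw hW hx
    have key : ∀ x ∈ W, ExteriorAlgebra.ι K x * CliffordAlgebra.contractLeft (φ 0) w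
        = φ 0 x • w := by
      intro x hxW
      have h := CliffordAlgebra.contractLeft_ι_mul (Q := (0 : QuadraticForm K V)) (d := φ 0) x w
      have h2 : CliffordAlgebra.ι (0 : QuadraticForm K V) x * w = 0 := hW x hxW
      rw [h2, map_zero] at h
      exact (sub_eq_zero.mp h.symm).symm
    rw [List.ofFn_succ, List.foldl_cons]
    apply ih (fun i => φ i.succ) (W ⊓ LinearMap.ker (φ 0))
    · obtain ⟨x, hxW, h1, -⟩ := hx 0
      intro h0
      have := key x hxW
      rw [h0, h1, mul_zero, one_smul] at this
      exact hw this.symm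
    · rintro x ⟨hxW, hx0⟩
      rw [key x hxW, LinearMap.mem_ker.mp hx0, zero_smul]
    · intro i
      obtain ⟨x, hxW, h1, h2⟩ := hx i.succ
      refine ⟨x, ⟨hxW, h2 0 (Fin.succ_ne_zero i).symm⟩, h1, fun j hj => h2 _ ?_⟩
      simpa using hj

theorem aux_zero {K : Type*} [Field K] {V : Type*} [AddCommGroup V] [Module K V] {a : ℕ}
    (φ : Fin a → Module.Dual K V) (h : ¬ LinearIndependent K φ) (w : ExteriorAlgebra K V) :
    (List.ofFn φ).foldl (fun v d => CliffordAlgebra.contractLeft d v) w = 0 := by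
  let F : ExteriorAlgebra K (Module.Dual K V) →ₐ[K] Module.End K (ExteriorAlgebra K V) :=
    ExteriorAlgebra.lift K ⟨CliffordAlgebra.contractLeft, fun d => by
      refine LinearMap.ext fun x => ?_
      exact CliffordAlgebra.contractLeft_contractLeft (d := d) x⟩
  have hF : ∀ d x, F (ExteriorAlgebra.ι K d) x = CliffordAlgebra.contractLeft d x := by
    intro d x
    simp only [F]
    rw [ExteriorAlgebra.lift_ι_apply]
  have gen : ∀ (l : List (Module.Dual K V)) (w : ExteriorAlgebra K V),
      l.foldl (fun v d => CliffordAlgebra.contractLeft d v) w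
        = F ((l.reverse.map (ExteriorAlgebra.ι K)).prod) w := by
    intro l
    induction l with
    | nil => intro w; simp
    | cons d l ih =>
      intro w
      rw [List.foldl_cons, ih, List.reverse_cons, List.map_append, List.prod_append, map_mul,
        Module.End.mul_apply]
      congr 1
      simp [hF]
  rw [gen]
  have h2 : ((List.ofFn φ).reverse.map (ExteriorAlgebra.ι K)).prod
      = ExteriorAlgebra.ιMulti K a (φ ∘ Fin.rev) := by
    have h4 : (List.ofFn φ).reverse = List.ofFn (φ ∘ Fin.rev) := by
      apply List.ext_getElem
      · simp
      · intro i h1 h2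
        simp only [List.getElem_reverse, List.getElem_ofFn, List.length_ofFn, Function.comp_apply]
        congr 1
        ext
        simp [Fin.val_rev]
        omega
    rw [ExteriorAlgebra.ιMulti_apply, h4, List.map_ofFn]
    rfl
  rw [h2, AlternatingMap.map_linearDependent, map_zero, LinearMap.zero_apply]
  intro h3
  apply h
  have := h3.comp Fin.rev Fin.rev_injective
  simpa [Function.comp_def] using this

theorem aux_omega {K : Type*} [Field K] (n : ℕ) :
    (List.ofFn fun i : Fin n => ExteriorAlgebra.ι K (Pi.single i (1 : K) : Fin n → K)).prod ≠ 0 := by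
  rw [← ExteriorAlgebra.ιMulti_apply (R := K) (fun i : Fin n => (Pi.single i (1 : K) : Fin n → K))]
  intro h
  have := congrArg (ExteriorAlgebra.liftAlternating (R := K) (N := K)
    (Pi.single n (Pi.basisFun K (Fin n)).det)) h
  rw [ExteriorAlgebra.liftAlternating_apply_ιMulti, map_zero, Pi.single_eq_same] at this
  have h2 := (Pi.basisFun K (Fin n)).det_self
  have h3 : ⇑(Pi.basisFun K (Fin n)) = fun i => Pi.single i (1 : K) := by
    ext i; simp
  rw [h3, this] at h2
  exact zero_ne_one h2

theorem aux_top {K : Type*} [Field K] (n : ℕ) (x : Fin n → K) :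
    ExteriorAlgebra.ι K x *
    (List.ofFn fun i : Fin n => ExteriorAlgebra.ι K (Pi.single i (1 : K) : Fin n → K)).prod = 0 := by
  rw [← ExteriorAlgebra.ιMulti_apply (R := K) (fun i : Fin n => (Pi.single i (1 : K) : Fin n → K))]
  have := ExteriorAlgebra.ιMulti_succ_apply (R := K) (M := Fin n → K)
    (v := Matrix.vecCons x (fun i : Fin n => (Pi.single i (1 : K) : Fin n → K)))
  simp only [Matrix.cons_val_zero, Matrix.vecTail, Function.comp_def, Matrix.cons_val_succ] at this
  rw [← this]
  apply AlternatingMap.map_linearDependent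
  intro h
  have := h.fintype_card_le_finrank
  simp at this

/-- Let `K` be a field, `n ≥ 1`, `0 ≤ a ≤ n`, `e₁, …, e_n` the standard basis of `Kⁿ` and
`φ₁, …, φ_a` linear functionals on `Kⁿ`.  In the exterior algebra of `Kⁿ`, the iterated left
contraction `ι_{φ_a}(⋯(ι_{φ₁}(e₁ ∧ ⋯ ∧ e_n))⋯)` is nonzero iff `φ₁, …, φ_a` are linearly
independent, equivalently iff `x ↦ (φ₁ x, …, φ_a x)` is surjective onto `K^a`. -/
theorem iterated_contraction_top_form_ne_zero_iff
    {K : Type*} [Field K] (n a : ℕ) (hn : 1 ≤ n) (ha : a ≤ n)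
    (φ : Fin a → Module.Dual K (Fin n → K)) :
    let ω : ExteriorAlgebra K (Fin n → K) :=
      (List.ofFn fun i : Fin n => ExteriorAlgebra.ι K (Pi.single i (1 : K))).prod
    let w : ExteriorAlgebra K (Fin n → K) :=
      (List.ofFn φ).foldl (fun v d => CliffordAlgebra.contractLeft d v) ω
    (w ≠ 0 ↔ LinearIndependent K φ) ∧
    (w ≠ 0 ↔ Function.Surjective fun x : Fin n → K => fun i : Fin a => φ i x) := by

  intro ω w
  have main : w ≠ 0 ↔ LinearIndependent K φ := by
    constructor
    · intro hw
      by_contra h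
      exact hw (aux_zero φ h ω)
    · intro h
      refine aux_nonzero a φ ⊤ ω (aux_omega n) (fun x _ => aux_top n x) fun i => ?_
      obtain ⟨x, hx⟩ := (aux_surj_iff φ).mp h (Pi.single i 1)
      refine ⟨x, trivial, by simpa using congrFun hx i, fun j hj => ?_⟩
      simpa [hj] using congrFun hx j
  exact ⟨main, main.trans (aux_surj_iff φ)⟩
end
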